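/- For every instance of the related machine scheduling game with m machines, every pure Nash equilibrium τ and every schedule σ satisfy SC(τ) ≤ (2 − 1/(2·(2m−1)))·SC(σ). In particular, the pure price of anarchy of Q||ΣC_j is at most 2 − 1/(2·(2m−1)). -/

import Mathlib

open Finset

/-- Completion time of job `j` under schedule `τ`: jobs are processed in SPT order
(ties broken by index), so `C_j(τ) = (∑_{k ≤ j, τ_k = τ_j} p_k) / s_{τ_j}`. -/
noncomputable def completionTime {n m : ℕ} (p : Fin n → ℝ) (s : Fin m → ℝ)
    (τ : Fin n → Fin m) (j : Fin n) : ℝ :=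
  (∑ k ∈ univ.filter (fun k => k ≤ j ∧ τ k = τ j), p k) / s (τ j)

/-- Social cost: sum of completion times. -/
noncomputable def socialCost {n m : ℕ} (p : Fin n → ℝ) (s : Fin m → ℝ)
    (τ : Fin n → Fin m) : ℝ :=
  ∑ j, completionTime p s τ j

/-- `τ` is a pure Nash equilibrium: no job can decrease its completion time by
moving to another machine. -/
def IsNash {n m : ℕ} (p : Fin n → ℝ) (s : Fin m → ℝ) (τ : Fin n → Fin m) : Prop :=
  ∀ (j : Fin n) (i : Fin m),
    completionTime p s τ j ≤
      (p j + ∑ k ∈ univ.filter (fun k => k < j ∧ τ k = i), p k) / s i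

/-- `ψ_i(τ, j)`: the number of jobs on machine `i` in schedule `τ` with strictly
lower priority than job `j`. -/
def psi {n m : ℕ} (τ : Fin n → Fin m) (i : Fin m) (j : Fin n) : ℕ :=
  (univ.filter (fun k => j < k ∧ τ k = i)).card

/-- The positional weight of job `j` under `σ`: the factor with which `p j` enters the social
cost. -/
noncomputable def slotWeight {n m : ℕ} (s : Fin m → ℝ) (σ : Fin n → Fin m) (j : Fin n) : ℝ :=
  (1 + (psi σ (σ j) j : ℝ)) / s (σ j)

/-- Every job, inserted from the longest to the shortest, takes a slot of minimal weight. -/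
def IsGreedy {n m : ℕ} (s : Fin m → ℝ) (σ : Fin n → Fin m) : Prop :=
  ∀ k i, slotWeight s σ k ≤ (1 + (psi σ i k : ℝ)) / s i

theorem sum_preceding_load_eq {n m : ℕ} (p : Fin n → ℝ) (s : Fin m → ℝ) (τ σ : Fin n → Fin m) :
    ∑ j, (∑ k ∈ univ.filter (fun k => k < j ∧ τ k = σ j), p k) / s (σ j) =
      ∑ k, p k * ((psi σ (τ k) k : ℝ) / s (τ k)) := by
  simp only [Finset.sum_div, Finset.sum_filter]
  rw [Finset.sum_comm]
  refine Finset.sum_congr rfl fun k _ => ?_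
  rw [psi, Finset.card_filter]
  push_cast
  rw [Finset.sum_div, Finset.mul_sum]
  refine Finset.sum_congr rfl fun j _ => ?_
  by_cases h : k < j ∧ σ j = τ k
  · rw [if_pos ⟨h.1, h.2.symm⟩, if_pos h, h.2]
    ring
  · rw [if_neg fun h' => h ⟨h'.1, h'.2.symm⟩, if_neg h]
    simp

theorem completionTime_eq {n m : ℕ} (p : Fin n → ℝ) (s : Fin m → ℝ) (τ : Fin n → Fin m)
    (j : Fin n) : completionTime p s τ j =
      p j / s (τ j) + (∑ k ∈ univ.filter (fun k => k < j ∧ τ k = τ j), p k) / s (τ j) := by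
  have h : univ.filter (fun k => k ≤ j ∧ τ k = τ j) =
      insert j (univ.filter (fun k => k < j ∧ τ k = τ j)) := by
    ext k
    simp only [mem_filter, mem_univ, true_and, mem_insert, le_iff_eq_or_lt]
    constructor
    · rintro ⟨h | h, h'⟩
      · exact Or.inl h
      · exact Or.inr ⟨h, h'⟩
    · rintro (rfl | ⟨h, h'⟩)
      · exact ⟨Or.inl rfl, rfl⟩
      · exact ⟨Or.inr h, h'⟩
  rw [completionTime, h, Finset.sum_insert (by simp), add_div]

theorem socialCost_eq_sum_slotWeight {n m : ℕ} (p : Fin n → ℝ) (s : Fin m → ℝ)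
    (σ : Fin n → Fin m) : socialCost p s σ = ∑ k, p k * slotWeight s σ k := by
  simp only [socialCost, completionTime_eq]
  rw [Finset.sum_add_distrib, sum_preceding_load_eq, ← Finset.sum_add_distrib]
  refine Finset.sum_congr rfl fun k _ => ?_
  rw [slotWeight]
  ring

theorem IsNash.socialCost_le {n m : ℕ} {p : Fin n → ℝ} {s : Fin m → ℝ} {τ : Fin n → Fin m}
    (hτ : IsNash p s τ) (σ : Fin n → Fin m) :
    socialCost p s τ ≤
      ∑ k, p k * (1 / s (σ k) + (psi σ (τ k) k : ℝ) / s (τ k)) := by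
  calc socialCost p s τ
      ≤ ∑ j, (p j + ∑ k ∈ univ.filter (fun k => k < j ∧ τ k = σ j), p k) / s (σ j) :=
        Finset.sum_le_sum fun j _ => hτ j (σ j)
    _ = _ := by
        simp only [add_div, Finset.sum_add_distrib, sum_preceding_load_eq, mul_add, mul_one_div]

theorem psi_cons_succ {n m : ℕ} (σ : Fin n → Fin m) (i₀ i : Fin m) (k : Fin n) :
    psi (Fin.cons i₀ σ : Fin (n + 1) → Fin m) i k.succ = psi σ i k := by
  simp only [psi, Finset.card_filter, Fin.sum_univ_succ]
  simp

theorem exists_isGreedy {m : ℕ} (hm : 0 < m) (s : Fin m → ℝ) (n : ℕ) :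
    ∃ σ : Fin n → Fin m, IsGreedy s σ := by
  induction n with
  | zero => exact ⟨Fin.elim0, fun k => k.elim0⟩
  | succ n ih =>
    obtain ⟨σ, hσ⟩ := ih
    have : Nonempty (Fin m) := ⟨⟨0, hm⟩⟩
    obtain ⟨i₀, h₀⟩ := Finite.exists_min
      (fun i => (1 + ((univ.filter (fun k => σ k = i)).card : ℝ)) / s i)
    have hzero : ∀ i, psi (Fin.cons i₀ σ : Fin (n + 1) → Fin m) i 0 =
        (univ.filter (fun k => σ k = i)).card := by
      intro i
      simp only [psi, Finset.card_filter, Fin.sum_univ_succ]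
      simp
    refine ⟨Fin.cons i₀ σ, fun k i => ?_⟩
    induction k using Fin.cases with
    | zero =>
      simp only [slotWeight, hzero, Fin.cons_zero]
      exact h₀ i
    | succ k =>
      simp only [slotWeight, psi_cons_succ, Fin.cons_succ]
      exact hσ k i

theorem psi_antitone {n m : ℕ} (σ : Fin n → Fin m) (i : Fin m) : Antitone (psi σ i) := by
  intro k l hkl
  refine Finset.card_le_card fun j => ?_
  simp only [mem_filter, mem_univ, true_and]
  exact fun h => ⟨hkl.trans_lt h.1, h.2⟩

theorem IsGreedy.psi_div_le {n m : ℕ} {s : Fin m → ℝ} (hs : ∀ i, 0 < s i) {σ : Fin n → Fin m}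
    (hσ : IsGreedy s σ) (i : Fin m) (k : Fin n) : (psi σ i k : ℝ) / s i ≤ slotWeight s σ k := by
  have hnonneg : 0 ≤ slotWeight s σ k := div_nonneg (by positivity) (hs _).le
  rcases (univ.filter (fun l => k < l ∧ σ l = i)).eq_empty_or_nonempty with h | h
  · simpa [psi, h] using hnonneg
  · obtain ⟨l, hl, hmin⟩ := Finset.exists_min_image _ id h
    simp only [mem_filter, mem_univ, true_and, id] at hl hmin
    have hcount : psi σ i k = 1 + psi σ i l := by
      have : univ.filter (fun j => k < j ∧ σ j = i) =
          insert l (univ.filter (fun j => l < j ∧ σ j = i)) := by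
        ext j
        simp only [mem_filter, mem_univ, true_and, mem_insert]
        constructor
        · intro hj
          rcases (hmin j hj).eq_or_lt with h' | h'
          · exact Or.inl h'.symm
          · exact Or.inr ⟨h', hj.2⟩
        · rintro (rfl | hj)
          · exact hl
          · exact ⟨hl.1.trans hj.1, hj.2⟩
      rw [psi, this, Finset.card_insert_of_notMem (by simp), psi, add_comm]
    calc (psi σ i k : ℝ) / s i = slotWeight s σ l := by
          rw [slotWeight, hl.2, hcount]; push_cast; rfl
      _ ≤ (1 + (psi σ (σ k) l : ℝ)) / s (σ k) := hσ l (σ k)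
      _ ≤ slotWeight s σ k := by
          have : (psi σ (σ k) l : ℝ) ≤ psi σ (σ k) k := by
            exact_mod_cast psi_antitone σ (σ k) hl.1.le
          rw [slotWeight]
          have := (hs (σ k)).le
          gcongr

theorem sum_card_filter_lt {α : Type*} [LinearOrder α] (F : Finset α) :
    ∑ k ∈ F, (1 + ((F.filter (fun l => k < l)).card : ℝ)) = (F.card : ℝ) * (F.card + 1) / 2 := by
  induction F using Finset.induction_on_min with
  | empty => simp
  | insert a F ha ih =>
    have haF : a ∉ F := fun h => lt_irrefl _ (ha a h)
    rw [Finset.sum_insert haF, Finset.card_insert_of_notMem haF]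
    have h1 : (insert a F).filter (fun l => a < l) = F := by
      rw [Finset.filter_insert, if_neg (lt_irrefl a), Finset.filter_true_of_mem ha]
    have h2 : ∀ k ∈ F, (1 + (((insert a F).filter (fun l => k < l)).card : ℝ)) =
        1 + ((F.filter (fun l => k < l)).card : ℝ) := by
      intro k hk
      rw [Finset.filter_insert, if_neg (ha k hk).not_gt]
    rw [h1, Finset.sum_congr rfl h2, ih]
    push_cast
    ring

theorem sum_slotWeight_suffix {n m : ℕ} (s : Fin m → ℝ) (σ : Fin n → Fin m) (t : Fin n) :
    ∑ k ∈ univ.filter (fun k => t ≤ k), slotWeight s σ k =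
      ∑ i, (((univ.filter (fun k => t ≤ k ∧ σ k = i)).card : ℝ) *
        ((univ.filter (fun k => t ≤ k ∧ σ k = i)).card + 1) / 2) / s i := by
  rw [← Finset.sum_fiberwise _ σ]
  refine Finset.sum_congr rfl fun i _ => ?_
  rw [← sum_card_filter_lt, Finset.sum_div, Finset.filter_filter]
  refine Finset.sum_congr rfl fun k hk => ?_
  simp only [mem_filter, mem_univ, true_and] at hk
  rw [slotWeight, hk.2, psi, Finset.filter_filter]
  congr 4
  ext j
  simp only [mem_filter, mem_univ, true_and]
  constructor
  · exact fun h => ⟨⟨hk.1.trans h.1.le, h.2⟩, h.1⟩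
  · exact fun h => ⟨h.2, h.1.2⟩

/-- The triangular numbers lie above each of their supporting lines with slope in `[M, M + 1]`. -/
theorem triangular_supporting_line (M N : ℕ) (x : ℝ) (hM : M ≤ x) (hM' : x ≤ M + 1) :
    (M : ℝ) * (M + 1) / 2 + x * (N - M) ≤ (N : ℝ) * (N + 1) / 2 := by
  rcases lt_trichotomy N M with h | rfl | h
  · have h' : (N : ℝ) + 1 ≤ M := by exact_mod_cast h
    nlinarith
  · linarith
  · have h' : (M : ℝ) + 1 ≤ N := by exact_mod_cast h
    nlinarith

theorem sum_card_suffix_fiber {n m : ℕ} (σ : Fin n → Fin m) (t : Fin n) :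
    ∑ i, ((univ.filter (fun k => t ≤ k ∧ σ k = i)).card : ℝ) =
      (univ.filter (fun k => t ≤ k)).card := by
  rw [Finset.card_eq_sum_card_fiberwise (f := σ) (t := univ) (by simp [Set.MapsTo])]
  push_cast
  simp only [Finset.filter_filter]

theorem card_suffix_fiber {n m : ℕ} (σ : Fin n → Fin m) (t : Fin n) (i : Fin m) :
    (univ.filter (fun k => t ≤ k ∧ σ k = i)).card = psi σ i t + if σ t = i then 1 else 0 := by
  split_ifs with h
  · rw [psi, ← Finset.card_insert_of_notMem (a := t) (by simp)]
    congr 1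
    ext k
    simp only [mem_filter, mem_univ, true_and, mem_insert, le_iff_eq_or_lt]
    grind
  · rw [psi, add_zero]
    congr 1
    ext k
    simp only [mem_filter, mem_univ, true_and, le_iff_eq_or_lt]
    grind

theorem IsGreedy.sum_slotWeight_suffix_le {n m : ℕ} {s : Fin m → ℝ} (hs : ∀ i, 0 < s i)
    {σ : Fin n → Fin m} (hσ : IsGreedy s σ) (ρ : Fin n → Fin m) (t : Fin n) :
    ∑ k ∈ univ.filter (fun k => t ≤ k), slotWeight s σ k ≤
      ∑ k ∈ univ.filter (fun k => t ≤ k), slotWeight s ρ k := by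
  rw [sum_slotWeight_suffix, sum_slotWeight_suffix]
  set M : Fin m → ℕ := fun i => (univ.filter (fun k => t ≤ k ∧ σ k = i)).card with hM
  set N : Fin m → ℕ := fun i => (univ.filter (fun k => t ≤ k ∧ ρ k = i)).card
  have hsum : ∑ i, slotWeight s σ t * ((N i : ℝ) - M i) = 0 := by
    rw [← Finset.mul_sum, Finset.sum_sub_distrib, sum_card_suffix_fiber, sum_card_suffix_fiber,
      sub_self, mul_zero]
  have hle : ∀ i, ((M i : ℝ) * (M i + 1) / 2) / s i + slotWeight s σ t * ((N i : ℝ) - M i) ≤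
      ((N i : ℝ) * (N i + 1) / 2) / s i := by
    intro i
    have hlow : (M i : ℝ) ≤ slotWeight s σ t * s i := by
      rw [← div_le_iff₀ (hs i)]
      by_cases h : σ t = i
      · simp [hM, card_suffix_fiber, h, slotWeight, add_comm]
      · simpa [hM, card_suffix_fiber, h] using hσ.psi_div_le hs i t
    have hupp : slotWeight s σ t * s i ≤ M i + 1 := by
      rw [← le_div_iff₀ (hs i)]
      refine (hσ t i).trans ?_
      have hsi := (hs i).le
      have : psi σ i t ≤ M i := by simp [hM, card_suffix_fiber]
      have : (psi σ i t : ℝ) ≤ M i := by exact_mod_cast this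
      rw [add_comm]
      gcongr
    have := triangular_supporting_line (M i) (N i) _ hlow hupp
    rw [le_div_iff₀ (hs i), add_mul, div_mul_cancel₀ _ (hs i).ne']
    linarith
  calc _ = ∑ i, (((M i : ℝ) * (M i + 1) / 2) / s i + slotWeight s σ t * ((N i : ℝ) - M i)) := by
        rw [Finset.sum_add_distrib, hsum, add_zero]
    _ ≤ _ := Finset.sum_le_sum fun i _ => hle i

theorem sum_mul_nonneg_of_suffix_nonneg {n : ℕ} (p c : Fin n → ℝ) (hp : ∀ k, 0 ≤ p k)
    (hmono : Monotone p) (hc : ∀ t, 0 ≤ ∑ k ∈ univ.filter (fun k => t ≤ k), c k) :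
    0 ≤ ∑ k, p k * c k := by
  induction n with
  | zero => simp
  | succ n ih =>
    have hfull : 0 ≤ ∑ k, c k := by simpa using hc 0
    have htail := ih (fun k => p k.succ - p 0) (fun k => c k.succ)
      (fun k => sub_nonneg.2 (hmono (Fin.zero_le _)))
      (fun k l h => sub_le_sub_right (hmono (Fin.succ_le_succ_iff.2 h)) _)
      (fun t => by simpa [Finset.sum_filter, Fin.sum_univ_succ] using hc t.succ)
    have hsplit : ∑ k, p k * c k = p 0 * ∑ k, c k + ∑ k : Fin n, (p k.succ - p 0) * c k.succ := by
      simp only [Fin.sum_univ_succ, sub_mul, Finset.sum_sub_distrib, ← Finset.mul_sum]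
      ring
    rw [hsplit]
    exact add_nonneg (mul_nonneg (hp 0) hfull) htail

theorem IsGreedy.socialCost_le {n m : ℕ} {p : Fin n → ℝ} {s : Fin m → ℝ} (hp : ∀ j, 0 < p j)
    (hpmono : Monotone p) (hs : ∀ i, 0 < s i) {σ : Fin n → Fin m} (hσ : IsGreedy s σ)
    (ρ : Fin n → Fin m) : socialCost p s σ ≤ socialCost p s ρ := by
  rw [socialCost_eq_sum_slotWeight, socialCost_eq_sum_slotWeight, ← sub_nonneg,
    ← Finset.sum_sub_distrib]
  simp only [← mul_sub]
  refine sum_mul_nonneg_of_suffix_nonneg p _ (fun k => (hp k).le) hpmono fun t => ?_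
  rw [Finset.sum_sub_distrib, sub_nonneg]
  exact hσ.sum_slotWeight_suffix_le hs ρ t

/-- At most one job per machine is processed last on its machine. -/
theorem card_filter_psi_eq_zero_le {n m : ℕ} (σ : Fin n → Fin m) :
    (univ.filter (fun k => psi σ (σ k) k = 0)).card ≤ m := by
  have hinj : Set.InjOn σ (univ.filter (fun k => psi σ (σ k) k = 0) : Finset (Fin n)) := by
    intro k hk l hl hkl
    simp only [coe_filter, mem_univ, true_and, Set.mem_ofPred_eq, psi, Finset.card_eq_zero,
      Finset.filter_eq_empty_iff, not_and] at hk hl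
    rcases lt_trichotomy k l with h | h | h
    · exact absurd hkl.symm (hk trivial h)
    · exact h
    · exact absurd hkl (hl trivial h)
  simpa using Finset.card_le_card_of_injOn σ (t := univ) (by simp) hinj

/-- The amount by which job `k` falls short of contributing twice its optimal cost to the
equilibrium bound. -/
noncomputable def slack {n m : ℕ} (p : Fin n → ℝ) (s : Fin m → ℝ) (τ σ : Fin n → Fin m)
    (k : Fin n) : ℝ :=
  p k * ((psi σ (σ k) k : ℝ) / s (σ k) + slotWeight s σ k - (psi σ (τ k) k : ℝ) / s (τ k))

theorem IsGreedy.socialCost_le_slack {n m : ℕ} {p : Fin n → ℝ} {s : Fin m → ℝ}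
    (hp : ∀ j, 0 < p j) (hpmono : Monotone p) (hs : ∀ i, 0 < s i) {σ : Fin n → Fin m}
    (hσ : IsGreedy s σ) (τ : Fin n → Fin m) :
    socialCost p s σ ≤ 2 * m * ∑ k, slack p s τ σ k := by
  rw [socialCost_eq_sum_slotWeight]
  rcases n with _ | n
  · simp
  have hbase : ∀ k, p k * ((psi σ (σ k) k : ℝ) / s (σ k)) ≤ slack p s τ σ k := fun k =>
    mul_le_mul_of_nonneg_left (by linarith [hσ.psi_div_le hs (τ k) k]) (hp k).le
  have hnonneg : ∀ k, 0 ≤ slack p s τ σ k := fun k =>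
    (mul_nonneg (hp k).le (div_nonneg (Nat.cast_nonneg _) (hs _).le)).trans (hbase k)
  set last := Fin.last n
  have hpsi : ∀ i, psi σ i last = 0 := by
    intro i
    simp only [psi, Finset.card_eq_zero, Finset.filter_eq_empty_iff, not_and]
    exact fun k _ h => absurd h (Fin.le_last k).not_gt
  have hslack_last : slack p s τ σ last = p last * slotWeight s σ last := by
    simp [slack, hpsi]
  set L := univ.filter (fun k => psi σ (σ k) k = 0) with hL
  have hmemL : last ∈ L := by simp [hL, hpsi]
  have hpos : ∀ k, k ∉ L → (1 : ℝ) ≤ psi σ (σ k) k := by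
    intro k hk
    simp only [hL, mem_filter, mem_univ, true_and] at hk
    exact_mod_cast Nat.one_le_iff_ne_zero.2 hk
  have hmachine : ∀ k, σ k = σ last → p k / s (σ last) ≤ slack p s τ σ k := by
    intro k hk
    by_cases hkL : k = last
    · rw [hkL, hslack_last, slotWeight, hpsi]
      simp [div_eq_mul_inv]
    · have hone : (1 : ℝ) ≤ psi σ (σ k) k := by
        have : 0 < psi σ (σ k) k := Finset.card_pos.2 ⟨last, by
          simpa [hk] using lt_of_le_of_ne (Fin.le_last k) hkL⟩
        exact_mod_cast this
      refine le_trans ?_ (hbase k)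
      rw [div_eq_mul_one_div, hk]
      have h1 := (hp k).le
      have h2 := (hs (σ last)).le
      rw [hk] at hone
      gcongr
  have hterm : ∀ k, p k * slotWeight s σ k ≤ 2 * slack p s τ σ k +
      if k ∈ L.erase last then 2 * ∑ l, slack p s τ σ l else 0 := by
    intro k
    by_cases hkl : k = last
    · have := hnonneg last
      simp only [hkl, Finset.notMem_erase, if_false, ← hslack_last]
      linarith
    by_cases hkL : k ∈ L
    · rw [if_pos (Finset.mem_erase.2 ⟨hkl, hkL⟩)]
      set F := univ.filter (fun l => k < l ∧ σ l = σ last) with hF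
      have hcard : (1 : ℝ) ≤ F.card := by
        have : 0 < F.card := Finset.card_pos.2 ⟨last, by
          simpa [hF] using lt_of_le_of_ne (Fin.le_last k) hkl⟩
        exact_mod_cast this
      have hsum : F.card * (p k / s (σ last)) ≤ ∑ l, slack p s τ σ l := by
        calc F.card * (p k / s (σ last)) = ∑ l ∈ F, p k / s (σ last) := by simp
          _ ≤ ∑ l ∈ F, slack p s τ σ l := by
            refine Finset.sum_le_sum fun l hl => ?_
            simp only [hF, mem_filter, mem_univ, true_and] at hl
            exact (div_le_div_of_nonneg_right (hpmono hl.1.le) (hs _).le).trans (hmachine l hl.2)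
          _ ≤ _ := Finset.sum_le_univ_sum_of_nonneg hnonneg
      have hweight : p k * slotWeight s σ k ≤ (1 + F.card) * (p k / s (σ last)) := by
        calc p k * slotWeight s σ k ≤ p k * ((1 + F.card) / s (σ last)) :=
              mul_le_mul_of_nonneg_left (hσ k (σ last)) (hp k).le
          _ = _ := by ring
      have hquot : 0 ≤ p k / s (σ last) := (div_pos (hp k) (hs _)).le
      nlinarith [hnonneg k]
    · rw [if_neg fun h => hkL (Finset.mem_of_mem_erase h), add_zero]
      refine le_trans ?_ (mul_le_mul_of_nonneg_left (hbase k) zero_le_two)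
      have h1 := hpos k hkL
      have h2 := (hs (σ k)).le
      calc p k * slotWeight s σ k
          ≤ p k * ((2 * psi σ (σ k) k) / s (σ k)) := by
            refine mul_le_mul_of_nonneg_left (div_le_div_of_nonneg_right ?_ h2) (hp k).le
            linarith
        _ = _ := by ring
  have hcardL : ((L.erase last).card : ℝ) + 1 ≤ m := by
    have := card_filter_psi_eq_zero_le σ
    rw [← Finset.card_erase_add_one hmemL] at this
    exact_mod_cast this
  calc ∑ k, p k * slotWeight s σ k
      ≤ ∑ k, (2 * slack p s τ σ k +
          if k ∈ L.erase last then 2 * ∑ l, slack p s τ σ l else 0) :=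
        Finset.sum_le_sum fun k _ => hterm k
    _ = 2 * (((L.erase last).card : ℝ) + 1) * ∑ k, slack p s τ σ k := by
        rw [Finset.sum_add_distrib, ← Finset.mul_sum, Finset.sum_ite_mem, Finset.univ_inter,
          Finset.sum_const, nsmul_eq_mul]
        ring
    _ ≤ 2 * m * ∑ k, slack p s τ σ k := by
        have := Finset.sum_nonneg fun k (_ : k ∈ univ) => hnonneg k
        gcongr

/-- Theorem 4: the pure price of anarchy for `Q||ΣC_j` with `m` machines is at
most `2 - 1/(2·(2m-1))`: every pure Nash equilibrium `τ` and every schedule `σ`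
satisfy `SC(τ) ≤ (2 - 1/(2·(2m-1)))·SC(σ)`. -/
theorem poa_general (n m : ℕ) (hm : 0 < m) (p : Fin n → ℝ) (s : Fin m → ℝ)
    (hp : ∀ j, 0 < p j) (hpmono : Monotone p) (hs : ∀ i, 0 < s i)
    (τ σ : Fin n → Fin m) (hτ : IsNash p s τ) :
    socialCost p s τ ≤ (2 - 1 / (2 * (2 * (m : ℝ) - 1))) * socialCost p s σ := by
  obtain ⟨ρ, hρ⟩ := exists_isGreedy hm s n
  have hm1 : (1 : ℝ) ≤ m := by exact_mod_cast hm
  have hopt : 0 ≤ socialCost p s ρ := by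
    rw [socialCost_eq_sum_slotWeight]
    exact Finset.sum_nonneg fun k _ =>
      mul_nonneg (hp k).le (div_nonneg (by positivity) (hs _).le)
  have hnash : socialCost p s τ ≤ 2 * socialCost p s ρ - ∑ k, slack p s τ ρ k := by
    refine (hτ.socialCost_le ρ).trans_eq ?_
    rw [socialCost_eq_sum_slotWeight, Finset.mul_sum, ← Finset.sum_sub_distrib]
    refine Finset.sum_congr rfl fun k _ => ?_
    rw [slack, slotWeight]
    ring
  have hslack : socialCost p s ρ / (2 * m) ≤ ∑ k, slack p s τ ρ k := by
    rw [div_le_iff₀' (by positivity)]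
    exact hρ.socialCost_le_slack hp hpmono hs τ
  have hcoef : 1 / (2 * (2 * (m : ℝ) - 1)) ≤ 1 / (2 * m) :=
    one_div_le_one_div_of_le (by positivity) (by linarith)
  have hcoef' : 1 / (2 * (m : ℝ)) ≤ 1 := by
    rw [div_le_one (by positivity)]
    linarith
  calc socialCost p s τ ≤ (2 - 1 / (2 * (m : ℝ))) * socialCost p s ρ := by
        rw [sub_mul, one_div_mul_eq_div]
        linarith
    _ ≤ (2 - 1 / (2 * (2 * (m : ℝ) - 1))) * socialCost p s ρ :=
        mul_le_mul_of_nonneg_right (by linarith) hopt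
    _ ≤ _ := mul_le_mul_of_nonneg_left (hρ.socialCost_le hp hpmono hs σ) (by linarith)
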